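/- Let k be a constant depending only on the Euclidean dimension n such that Ā_j ⊆ B_{kε}(x) whenever x ∈ A_j. For every grid θ of side ε and every ε > 0, the logarithmic partition functions satisfy Γ^l_μ(kε) ≥ Ψ^l_μ(θ,ε) ≥ Γ^l_μ(ε). -/

import Mathlib

open MeasureTheory Filter Set
open scoped ENNReal Topology NNReal

noncomputable section

/-- First return time of `x` to the set `A` under the map `T`;
by convention it is `0` if the orbit of `x` never returns to `A`. -/
def firstReturn {α : Type*} (T : α → α) (A : Set α) (x : α) : ℕ :=
  sInf {k : ℕ | 0 < k ∧ T^[k] x ∈ A}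

/-- Extended logarithm `ℝ≥0∞ → EReal`. -/
def elog (x : ℝ≥0∞) : EReal :=
  if x = 0 then ⊥ else if x = ⊤ then ⊤ else ((Real.log x.toReal : ℝ) : EReal)

section Generic

variable {α : Type*} [MeasurableSpace α] [PseudoMetricSpace α]

/-- The measure partition function `Γ_μ(ε,q)`. -/
def measPF (μ : Measure α) (ε q : ℝ) : ℝ≥0∞ :=
  ∫⁻ x, μ (Metric.ball x ε) ^ (q - 1) ∂μ

/-- The logarithmic measure partition function `Γ^l_μ(ε)`. -/
def measPFlog (μ : Measure α) (ε : ℝ) : ℝ :=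
  ∫ x, Real.log (μ (Metric.ball x ε)).toReal ∂μ

/-- The return time partition function `Γ_τ(ε,q)`. -/
def retPF (T : α → α) (μ : Measure α) (ε q : ℝ) : ℝ≥0∞ :=
  ∫⁻ x, (firstReturn T (Metric.ball x ε) x : ℝ≥0∞) ^ (1 - q) ∂μ

/-- The logarithmic return time partition function `Γ^l_τ(ε)`. -/
def retPFlog (T : α → α) (μ : Measure α) (ε : ℝ) : ℝ :=
  ∫ x, Real.log ((firstReturn T (Metric.ball x ε) x : ℝ))⁻¹ ∂μ

/-- The scaling exponent `(1/(q-1)) · log F(ε) / log ε`. -/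
def dimScale (F : ℝ → ℝ≥0∞) (q : ℝ) (ε : ℝ) : EReal :=
  ((((q - 1) * Real.log ε)⁻¹ : ℝ) : EReal) * elog (F ε)

/-- Upper generalized dimension obtained from a one-parameter family of partition
functions `F ε`, with the logarithmic convention at `q = 1`. -/
def dimPlus (F : ℝ → ℝ≥0∞) (Flog : ℝ → ℝ) (q : ℝ) : EReal :=
  if q = 1 then ((limsup (fun ε => Flog ε / Real.log ε) (𝓝[>] (0:ℝ)) : ℝ) : EReal)
  else limsup (dimScale F q) (𝓝[>] (0:ℝ))

/-- Lower generalized dimension. -/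
def dimMinus (F : ℝ → ℝ≥0∞) (Flog : ℝ → ℝ) (q : ℝ) : EReal :=
  if q = 1 then ((liminf (fun ε => Flog ε / Real.log ε) (𝓝[>] (0:ℝ)) : ℝ) : EReal)
  else liminf (dimScale F q) (𝓝[>] (0:ℝ))

/-- Generalized measure dimensions `D_μ^+(q)`. -/
def DmuPlus (μ : Measure α) (q : ℝ) : EReal :=
  dimPlus (fun ε => measPF μ ε q) (measPFlog μ) q

/-- Generalized measure dimensions `D_μ^-(q)`. -/
def DmuMinus (μ : Measure α) (q : ℝ) : EReal :=
  dimMinus (fun ε => measPF μ ε q) (measPFlog μ) q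

/-- Return time generalized dimensions `D_τ^+(q)`. -/
def DtauPlus (T : α → α) (μ : Measure α) (q : ℝ) : EReal :=
  dimPlus (fun ε => retPF T μ ε q) (retPFlog T μ) q

/-- Return time generalized dimensions `D_τ^-(q)`. -/
def DtauMinus (T : α → α) (μ : Measure α) (q : ℝ) : EReal :=
  dimMinus (fun ε => retPF T μ ε q) (retPFlog T μ) q

end Generic

/-- Euclidean space `ℝ^n`. -/
abbrev Euc (n : ℕ) := EuclideanSpace ℝ (Fin n)

/-- A grid in `ℝ^n` : a choice of origin and orientation, determining for every
side length `ε` a partition of `ℝ^n` into half-open cubes of side `ε`. -/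
structure Grid (n : ℕ) where
  origin : Euc n
  rot : Euc n ≃ₗᵢ[ℝ] Euc n

/-- Coordinates of a point w.r.t. a grid. -/
def Grid.coords {n : ℕ} (θ : Grid n) (x : Euc n) : Fin n → ℝ :=
  fun i => θ.rot.symm (x - θ.origin) i

/-- The cube `A_j` of side `ε` of the grid `θ`, indexed by `j : Fin n → ℤ`. -/
def Grid.box {n : ℕ} (θ : Grid n) (ε : ℝ) (j : Fin n → ℤ) : Set (Euc n) :=
  {x | ∀ i, (j i : ℝ) * ε ≤ θ.coords x i ∧ θ.coords x i < ((j i : ℝ) + 1) * ε}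

/-- The enlarged cube `Ā_j` of side `3ε` concentric with `A_j`. -/
def Grid.bigBox {n : ℕ} (θ : Grid n) (ε : ℝ) (j : Fin n → ℤ) : Set (Euc n) :=
  {x | ∀ i, ((j i : ℝ) - 1) * ε ≤ θ.coords x i ∧ θ.coords x i < ((j i : ℝ) + 2) * ε}

/-- Box measure partition function `Υ_μ(θ,ε,q) = Σ_{μ(A_j)>0} μ(A_j)^q`. -/
def boxMeasPF {n : ℕ} (μ : Measure (Euc n)) (θ : Grid n) (ε q : ℝ) : ℝ≥0∞ :=
  ∑' j : Fin n → ℤ, if μ (θ.box ε j) = 0 then 0 else μ (θ.box ε j) ^ q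

/-- Logarithmic box measure partition function `Υ^l_μ(θ,ε)`. -/
def boxMeasPFlog {n : ℕ} (μ : Measure (Euc n)) (θ : Grid n) (ε : ℝ) : ℝ :=
  ∑' j : Fin n → ℤ, (μ (θ.box ε j)).toReal * Real.log (μ (θ.box ε j)).toReal

/-- Return time box partition function `Υ_τ(θ,ε,q)`. -/
def boxRetPF {n : ℕ} (T : Euc n → Euc n) (μ : Measure (Euc n)) (θ : Grid n)
    (ε q : ℝ) : ℝ≥0∞ :=
  ∑' j : Fin n → ℤ, ∫⁻ x in θ.box ε j,
    (firstReturn T (θ.box ε j) x : ℝ≥0∞) ^ (1 - q) ∂μ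

/-- Logarithmic return time box partition function `Υ^l_τ(θ,ε)`. -/
def boxRetPFlog {n : ℕ} (T : Euc n → Euc n) (μ : Measure (Euc n)) (θ : Grid n)
    (ε : ℝ) : ℝ :=
  ∑' j : Fin n → ℤ, ∫ x in θ.box ε j,
    Real.log ((firstReturn T (θ.box ε j) x : ℝ))⁻¹ ∂μ

/-- Riedi's enhanced box partition function `Φ_μ(θ,ε,q)`. -/
def riediPF {n : ℕ} (μ : Measure (Euc n)) (θ : Grid n) (ε q : ℝ) : ℝ≥0∞ :=
  ∑' j : Fin n → ℤ, if μ (θ.box ε j) = 0 then 0 else μ (θ.bigBox ε j) ^ q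

/-- The enhanced box partition function `Ψ_μ(θ,ε,q) = Σ_{μ(A_j)>0} μ(A_j) μ(Ā_j)^{q-1}`. -/
def psiMeasPF {n : ℕ} (μ : Measure (Euc n)) (θ : Grid n) (ε q : ℝ) : ℝ≥0∞ :=
  ∑' j : Fin n → ℤ,
    if μ (θ.box ε j) = 0 then 0 else μ (θ.box ε j) * μ (θ.bigBox ε j) ^ (q - 1)

/-- The logarithmic enhanced box partition function `Ψ^l_μ(θ,ε)`. -/
def psiMeasPFlog {n : ℕ} (μ : Measure (Euc n)) (θ : Grid n) (ε : ℝ) : ℝ :=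
  ∑' j : Fin n → ℤ, (μ (θ.box ε j)).toReal * Real.log (μ (θ.bigBox ε j)).toReal

/-- The enhanced return time box partition function `Ψ_τ(θ,ε,q)`:
the integral is over `A_j` but the return is to the enlarged box `Ā_j`. -/
def psiRetPF {n : ℕ} (T : Euc n → Euc n) (μ : Measure (Euc n)) (θ : Grid n)
    (ε q : ℝ) : ℝ≥0∞ :=
  ∑' j : Fin n → ℤ, ∫⁻ x in θ.box ε j,
    (firstReturn T (θ.bigBox ε j) x : ℝ≥0∞) ^ (1 - q) ∂μ

/-- Box measure dimensions `Δ_μ^+(θ,q)`. -/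
def DeltaMuPlus {n : ℕ} (μ : Measure (Euc n)) (θ : Grid n) (q : ℝ) : EReal :=
  dimPlus (fun ε => boxMeasPF μ θ ε q) (boxMeasPFlog μ θ) q

/-- Box measure dimensions `Δ_μ^-(θ,q)`. -/
def DeltaMuMinus {n : ℕ} (μ : Measure (Euc n)) (θ : Grid n) (q : ℝ) : EReal :=
  dimMinus (fun ε => boxMeasPF μ θ ε q) (boxMeasPFlog μ θ) q

/-- Box return time dimensions `Δ_τ^+(θ,q)`. -/
def DeltaTauPlus {n : ℕ} (T : Euc n → Euc n) (μ : Measure (Euc n)) (θ : Grid n)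
    (q : ℝ) : EReal :=
  dimPlus (fun ε => boxRetPF T μ θ ε q) (boxRetPFlog T μ θ) q

/-- Box return time dimensions `Δ_τ^-(θ,q)`. -/
def DeltaTauMinus {n : ℕ} (T : Euc n → Euc n) (μ : Measure (Euc n)) (θ : Grid n)
    (q : ℝ) : EReal :=
  dimMinus (fun ε => boxRetPF T μ θ ε q) (boxRetPFlog T μ θ) q

end

/-- On a set of full measure that is compact, balls of a fixed radius have measure
essentially bounded below. -/
theorem exists_pos_ae_le_measure_ball {α : Type*} [MeasurableSpace α] [PseudoMetricSpace α]
    {μ : Measure α} [IsFiniteMeasure μ] {X : Set α} (hX : IsCompact X) (hμX : ∀ᵐ x ∂μ, x ∈ X)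
    {r : ℝ} (hr : 0 < r) :
    ∃ c : ℝ, 0 < c ∧ ∀ᵐ x ∂μ, c ≤ (μ (Metric.ball x r)).toReal := by
  obtain ⟨t, -, ht, hcover⟩ := hX.finite_cover_balls (half_pos hr)
  have hsmall : ∀ᶠ c in 𝓝[>] (0 : ℝ), ∀ z ∈ t, μ (Metric.ball z (r / 2)) ≠ 0 →
      c ≤ (μ (Metric.ball z (r / 2))).toReal := by
    refine (eventually_all_finite ht).2 fun z _ => ?_
    by_cases hz : μ (Metric.ball z (r / 2)) = 0
    · simp [hz]
    · filter_upwards [Ioo_mem_nhdsGT (ENNReal.toReal_pos hz (measure_ne_top _ _))] with c hc _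
        using hc.2.le
  obtain ⟨c, hc, hc0⟩ := (hsmall.and self_mem_nhdsWithin).exists
  have hnull : ∀ᵐ x ∂μ, ∀ z ∈ t, μ (Metric.ball z (r / 2)) = 0 → x ∉ Metric.ball z (r / 2) :=
    (ae_ball_iff ht.countable).2 fun z _ => by
      by_cases hz : μ (Metric.ball z (r / 2)) = 0
      · filter_upwards [measure_eq_zero_iff_ae_notMem.1 hz] with x hx _ using hx
      · simp [hz]
  refine ⟨c, hc0, ?_⟩
  filter_upwards [hμX, hnull] with x hxX hx
  obtain ⟨z, hz, hxz⟩ := mem_iUnion₂.1 (hcover hxX)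
  refine (hc z hz fun h => hx z hz h hxz).trans
    (ENNReal.toReal_mono (measure_ne_top _ _) (measure_mono ?_))
  rw [Metric.mem_ball, dist_comm] at hxz
  exact Metric.ball_subset_ball' (by linarith)

theorem measurable_measure_ball {α : Type*} [MeasurableSpace α] [PseudoMetricSpace α]
    [SecondCountableTopology α] [OpensMeasurableSpace α] (μ : Measure α) [SFinite μ] (r : ℝ) :
    Measurable fun x => μ (Metric.ball x r) := by
  have h : MeasurableSet {p : α × α | dist p.2 p.1 < r} :=
    measurableSet_lt (measurable_snd.dist measurable_fst) measurable_const
  exact measurable_measure_prodMk_left h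

theorem integrable_log_measure_ball {α : Type*} [MeasurableSpace α] [PseudoMetricSpace α]
    [SecondCountableTopology α] [OpensMeasurableSpace α] {μ : Measure α} [IsProbabilityMeasure μ]
    {X : Set α} (hX : IsCompact X) (hμX : ∀ᵐ x ∂μ, x ∈ X) {r : ℝ} (hr : 0 < r) :
    Integrable (fun x => Real.log (μ (Metric.ball x r)).toReal) μ := by
  obtain ⟨c, hc0, hc⟩ := exists_pos_ae_le_measure_ball hX hμX hr
  refine Integrable.of_bound
    (Real.measurable_log.comp
      (measurable_measure_ball μ r).ennreal_toReal).aestronglyMeasurable (-Real.log c) ?_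
  filter_upwards [hc] with x hx
  rw [Real.norm_of_nonpos (Real.log_nonpos ENNReal.toReal_nonneg measureReal_le_one)]
  exact neg_le_neg (Real.log_le_log hc0 hx)

/-- The index of the cube of side `ε` containing a given point. -/
noncomputable def Grid.index {n : ℕ} (θ : Grid n) (ε : ℝ) (x : Euc n) : Fin n → ℤ :=
  fun i => ⌊θ.coords x i / ε⌋

theorem Grid.mem_box_iff {n : ℕ} (θ : Grid n) {ε : ℝ} (hε : 0 < ε) (j : Fin n → ℤ) (x : Euc n) :
    x ∈ θ.box ε j ↔ θ.index ε x = j := by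
  simp only [Grid.box, mem_ofPred_eq, Grid.index, funext_iff, Int.floor_eq_iff, le_div_iff₀ hε,
    div_lt_iff₀ hε]

theorem Grid.mem_box_index {n : ℕ} (θ : Grid n) {ε : ℝ} (hε : 0 < ε) (x : Euc n) :
    x ∈ θ.box ε (θ.index ε x) :=
  (θ.mem_box_iff hε _ x).2 rfl

theorem Grid.measurable_coords {n : ℕ} (θ : Grid n) (i : Fin n) :
    Measurable fun x => θ.coords x i := by
  have h : Continuous fun x => θ.coords x i := by
    unfold Grid.coords
    fun_prop
  exact h.measurable

theorem Grid.measurable_index {n : ℕ} (θ : Grid n) (ε : ℝ) : Measurable (θ.index ε) :=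
  measurable_pi_lambda _ fun i => ((θ.measurable_coords i).div_const ε).floor

theorem Grid.abs_coords_sub_le_dist {n : ℕ} (θ : Grid n) (x y : Euc n) (i : Fin n) :
    |θ.coords x i - θ.coords y i| ≤ dist x y := by
  have h : θ.coords x i - θ.coords y i = θ.rot.symm (x - y) i := by
    rw [← sub_sub_sub_cancel_right x y θ.origin, map_sub]
    rfl
  rw [h, dist_eq_norm, ← θ.rot.symm.norm_map (x - y)]
  exact PiLp.norm_apply_le (θ.rot.symm (x - y)) i

theorem Grid.ball_subset_bigBox {n : ℕ} (θ : Grid n) {ε : ℝ} {j : Fin n → ℤ} {x : Euc n}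
    (hx : x ∈ θ.box ε j) : Metric.ball x ε ⊆ θ.bigBox ε j := by
  intro y hy i
  have h := abs_lt.1 ((θ.abs_coords_sub_le_dist y x i).trans_lt hy)
  have hxi := hx i
  constructor <;> linarith

theorem psiMeasPFlog_eq_integral {n : ℕ} (μ : Measure (Euc n)) (θ : Grid n) {ε : ℝ} (hε : 0 < ε)
    (hint : Integrable (fun x => Real.log (μ (θ.bigBox ε (θ.index ε x))).toReal) μ) :
    psiMeasPFlog μ θ ε = ∫ x, Real.log (μ (θ.bigBox ε (θ.index ε x))).toReal ∂μ := by
  have hm := θ.measurable_index ε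
  have hf : StronglyMeasurable fun j => Real.log (μ (θ.bigBox ε j)).toReal :=
    (measurable_of_countable _).stronglyMeasurable
  have hint' : Integrable (fun j => Real.log (μ (θ.bigBox ε j)).toReal) (μ.map (θ.index ε)) :=
    (integrable_map_measure hf.aestronglyMeasurable hm.aemeasurable).2 hint
  rw [← integral_map hm.aemeasurable hf.aestronglyMeasurable, integral_countable hint',
    psiMeasPFlog]
  refine tsum_congr fun j => ?_
  have hbox : θ.index ε ⁻¹' {j} = θ.box ε j := by
    ext x
    exact (θ.mem_box_iff hε j x).symm
  rw [measureReal_def, Measure.map_apply hm (measurableSet_singleton j), hbox, smul_eq_mul]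

/-- The logarithmic partition functions satisfy
`Γ^l_μ(kε) ≥ Ψ^l_μ(θ,ε) ≥ Γ^l_μ(ε)`, where `k` is a dimension-dependent constant
such that `Ā_j ⊆ B_{kε}(x)` whenever `x ∈ A_j`. -/
theorem log_measure_partition_function_inequalities {n : ℕ} (μ : Measure (Euc n))
    [IsProbabilityMeasure μ] (X : Set (Euc n)) (hXc : IsCompact X) (hX1 : μ X = 1)
    (k : ℝ)
    (hk : ∀ (θ : Grid n) (ε : ℝ), 0 < ε → ∀ (j : Fin n → ℤ) (x : Euc n),
      x ∈ θ.box ε j → θ.bigBox ε j ⊆ Metric.ball x (k * ε)) :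
    ∀ (θ : Grid n) (ε : ℝ), 0 < ε →
      measPFlog μ ε ≤ psiMeasPFlog μ θ ε ∧ psiMeasPFlog μ θ ε ≤ measPFlog μ (k * ε) := by
  intro θ ε hε
  have hμX : ∀ᵐ x ∂μ, x ∈ X := (mem_ae_iff_prob_eq_one hXc.measurableSet).2 hX1
  have hkε : 0 < k * ε := by
    have h0 := θ.mem_box_index hε 0
    exact Metric.pos_of_mem_ball
      (hk θ ε hε _ 0 h0 (θ.ball_subset_bigBox h0 (Metric.mem_ball_self hε)))
  obtain ⟨c, hc0, hc⟩ := exists_pos_ae_le_measure_ball hXc hμX hε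
  have hball := integrable_log_measure_ball hXc hμX hε
  have hle : ∀ᵐ x ∂μ, Real.log (μ (Metric.ball x ε)).toReal ≤
      Real.log (μ (θ.bigBox ε (θ.index ε x))).toReal := by
    filter_upwards [hc] with x hx
    exact Real.log_le_log (hc0.trans_le hx) (ENNReal.toReal_mono (measure_ne_top _ _)
      (measure_mono (θ.ball_subset_bigBox (θ.mem_box_index hε x))))
  have hle' : ∀ᵐ x ∂μ, Real.log (μ (θ.bigBox ε (θ.index ε x))).toReal ≤
      Real.log (μ (Metric.ball x (k * ε))).toReal := by
    filter_upwards [hc] with x hx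
    have hx' := θ.mem_box_index hε x
    exact Real.log_le_log
      ((hc0.trans_le hx).trans_le (ENNReal.toReal_mono (measure_ne_top _ _)
        (measure_mono (θ.ball_subset_bigBox hx'))))
      (ENNReal.toReal_mono (measure_ne_top _ _) (measure_mono (hk θ ε hε _ x hx')))
  have hbox : Integrable (fun x => Real.log (μ (θ.bigBox ε (θ.index ε x))).toReal) μ := by
    refine hball.mono ((measurable_of_countable fun j =>
      Real.log (μ (θ.bigBox ε j)).toReal).comp (θ.measurable_index ε)).aestronglyMeasurable ?_
    filter_upwards [hle] with x hx
    rw [Real.norm_of_nonpos (Real.log_nonpos ENNReal.toReal_nonneg measureReal_le_one),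
      Real.norm_of_nonpos (Real.log_nonpos ENNReal.toReal_nonneg measureReal_le_one)]
    exact neg_le_neg hx
  rw [psiMeasPFlog_eq_integral μ θ hε hbox]
  exact ⟨integral_mono_ae hball hbox hle,
    integral_mono_ae hbox (integrable_log_measure_ball hXc hμX hkε) hle'⟩
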